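/- arXiv:2307.00238 — 4 statements merged into one kernel-verified Lean document; each statement's English description precedes it below -/
import Mathlib

section
/- Let K ≥ 1, p ≥ 1 and sample sizes n_0, n_1, …, n_K ≥ 1 with n = n_0 + n_1 + ⋯ + n_K. For k = 0, 1, …, K let X_k ∈ ℝ^{n_k × p} and set Σ̂_k = (1/n_k) X_kᵀ X_k, and let X ∈ ℝ^{n × (K+1)p} be the stacked design matrix with Σ̂ = (1/n) Xᵀ X. Suppose there are constants v_k > 0 and τ_k ≥ 0 such that for every k ∈ {0, 1, …, K} and every Δ ∈ ℝ^p one has Δᵀ Σ̂_k Δ ≥ v_k ‖Δ‖₂² − τ_k √(log p / n_k) ‖Δ‖₁. Then, with v′ = (1/(2K+1)) · min_{0 ≤ k ≤ K} (v_k n_k / n), τ₀ = (K+1) · max_{0 ≤ k ≤ K} τ_k, and n_m = max_{1 ≤ k ≤ K} n_k, for every Δ ∈ ℝ^{(K+1)p} one has Δᵀ Σ̂ Δ ≥ v′ ‖Δ‖₂² − τ₀ (√(n_m log p / n²) + √(n_0 log p / n²)) ‖Δ‖₁. -/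
open Matrix Real

noncomputable section

/-- The stacked design matrix of the unified transfer learning model.
Block index `0` plays the role of the target data; block `k ≠ 0` is the `k`-th
source data.  The row block `k ≠ 0` contains `Xmat k` in column blocks `k` and `0`;
the row block `0` contains `Xmat 0` in column block `0`; all other entries vanish. -/
def stackedX (K p : ℕ) (n : Fin (K + 1) → ℕ)
    (Xmat : (k : Fin (K + 1)) → Matrix (Fin (n k)) (Fin p) ℝ) :
    Matrix ((k : Fin (K + 1)) × Fin (n k)) (Fin (K + 1) × Fin p) ℝ :=
  fun r c => if c.1 = r.1 ∨ c.1 = 0 then Xmat r.1 r.2 c.2 else 0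

theorem quad_eq {ι κ : Type*} [Fintype ι] [Fintype κ] (A : Matrix ι κ ℝ) (c : ℝ) (x : κ → ℝ) :
    x ⬝ᵥ ((c • (Aᵀ * A)) *ᵥ x) = c * ∑ r, (A *ᵥ x) r ^ 2 := by
  rw [Matrix.smul_mulVec, dotProduct_smul, ← Matrix.mulVec_mulVec, Matrix.dotProduct_mulVec,
    Matrix.vecMul_transpose, smul_eq_mul]
  simp [dotProduct, sq]

/-- The effective coefficient of row block `k`. -/
def effU (K p : ℕ) (Δ : Fin (K + 1) × Fin p → ℝ) (k : Fin (K + 1)) (j : Fin p) : ℝ :=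
  if k = 0 then Δ (0, j) else Δ (k, j) + Δ (0, j)

theorem stacked_mulVec (K p : ℕ) (n : Fin (K + 1) → ℕ)
    (Xmat : (k : Fin (K + 1)) → Matrix (Fin (n k)) (Fin p) ℝ)
    (Δ : Fin (K + 1) × Fin p → ℝ) (k : Fin (K + 1)) (i : Fin (n k)) :
    (stackedX K p n Xmat *ᵥ Δ) ⟨k, i⟩ = (Xmat k *ᵥ effU K p Δ k) i := by
  simp only [Matrix.mulVec, dotProduct, stackedX, effU, Fintype.sum_prod_type]
  rw [Finset.sum_comm]
  refine Finset.sum_congr rfl fun j _ => ?_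
  by_cases hk : k = 0
  · subst hk
    simp [ite_mul]
  · rw [if_neg hk]
    have : ∀ x : Fin (K + 1), (if x = k ∨ x = 0 then Xmat k i j else 0) * Δ (x, j)
        = (if x = k then Xmat k i j * Δ (x, j) else 0)
          + (if x = 0 then Xmat k i j * Δ (x, j) else 0) := by
      intro x
      by_cases h1 : x = k
      · subst h1
        simp [hk]
      · by_cases h2 : x = 0 <;> simp [h1, h2]
        intro h3
        exact absurd h3.symm hk
    simp only [this, Finset.sum_add_distrib, Finset.sum_ite_eq', Finset.mem_univ, if_true]
    ring

/-- Theorem 1 of the paper: restricted strong convexity of the stacked sample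
covariance matrix, with the explicit constants from its proof. -/
theorem rsc_stacked (K p : ℕ) (hK : 1 ≤ K) (hp : 1 ≤ p)
    (n : Fin (K + 1) → ℕ) (hn : ∀ k, 1 ≤ n k)
    (Xmat : (k : Fin (K + 1)) → Matrix (Fin (n k)) (Fin p) ℝ)
    (v τ : Fin (K + 1) → ℝ) (hv : ∀ k, 0 < v k) (hτ : ∀ k, 0 ≤ τ k)
    (hRSC : ∀ k, ∀ Δ : Fin p → ℝ,
      Δ ⬝ᵥ (((1 / (n k : ℝ)) • ((Xmat k)ᵀ * Xmat k)) *ᵥ Δ) ≥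
        v k * (∑ j, Δ j ^ 2) -
          τ k * Real.sqrt (Real.log p / (n k : ℝ)) * (∑ j, |Δ j|)) :
    ∀ Δ : Fin (K + 1) × Fin p → ℝ,
      Δ ⬝ᵥ (((1 / ((∑ k, n k : ℕ) : ℝ)) •
          ((stackedX K p n Xmat)ᵀ * stackedX K p n Xmat)) *ᵥ Δ) ≥
        ((1 / (2 * (K : ℝ) + 1)) * ⨅ k, v k * (n k : ℝ) / ((∑ k, n k : ℕ) : ℝ)) *
            (∑ i, Δ i ^ 2) -
          (((K : ℝ) + 1) * ⨆ k, τ k) *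
            (Real.sqrt ((⨆ k : Fin K, (n k.succ : ℝ)) * Real.log p /
                ((∑ k, n k : ℕ) : ℝ) ^ 2) +
              Real.sqrt ((n 0 : ℝ) * Real.log p / ((∑ k, n k : ℕ) : ℝ) ^ 2)) *
            (∑ i, |Δ i|) := by
  intro Δ
  set N : ℝ := ((∑ k, n k : ℕ) : ℝ) with hN
  have hnpos : ∀ k, (0 : ℝ) < n k := fun k => by exact_mod_cast hn k
  have hNpos : 0 < N := by
    rw [hN]; push_cast
    exact Finset.sum_pos (fun k _ => hnpos k) Finset.univ_nonempty
  set L := Real.log p with hL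
  have hL0 : 0 ≤ L := Real.log_natCast_nonneg p
  set m := ⨅ k, v k * (n k : ℝ) / N with hm
  set T := ⨆ k, τ k with hT
  set M := ⨆ k : Fin K, (n k.succ : ℝ) with hM
  set A := Real.sqrt (M * L / N ^ 2) with hA
  set B := Real.sqrt ((n 0 : ℝ) * L / N ^ 2) with hB
  have hmle : ∀ k, m ≤ v k * (n k : ℝ) / N := fun k =>
    ciInf_le (Set.finite_range _).bddBelow k
  have hm0 : 0 ≤ m := Real.iInf_nonneg fun k =>
    div_nonneg (mul_nonneg (hv k).le (hnpos k).le) hNpos.le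
  have hTle : ∀ k, τ k ≤ T := fun k => le_ciSup (Set.finite_range τ).bddAbove k
  have hT0 : 0 ≤ T := (hτ 0).trans (hTle 0)
  have hMle : ∀ k : Fin K, (n k.succ : ℝ) ≤ M := fun k =>
    le_ciSup (f := fun k : Fin K => (n k.succ : ℝ)) (Set.finite_range _).bddAbove k
  have hA0 : 0 ≤ A := Real.sqrt_nonneg _
  have hB0 : 0 ≤ B := Real.sqrt_nonneg _
  rw [quad_eq, Fintype.sum_sigma]
  simp only [stacked_mulVec]
  simp only [quad_eq] at hRSC
  set U := effU K p Δ with hU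
  -- per-block bound
  have key : ∀ k, (1 / N) * ∑ i, (Xmat k *ᵥ U k) i ^ 2 ≥
      m * (∑ j, U k j ^ 2) - T * Real.sqrt ((n k : ℝ) * L / N ^ 2) * ∑ j, |U k j| := by
    intro k
    have h := hRSC k (U k)
    have hs : Real.sqrt ((n k : ℝ) * L / N ^ 2) = (n k : ℝ) / N * Real.sqrt (L / n k) := by
      have : (n k : ℝ) * L / N ^ 2 = ((n k : ℝ) / N) ^ 2 * (L / n k) := by
        have := (hnpos k).ne'
        field_simp
      rw [this, Real.sqrt_mul (sq_nonneg _), Real.sqrt_sq (div_nonneg (hnpos k).le hNpos.le)]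
    have h2 : (n k : ℝ) / N * (1 / (n k : ℝ) * ∑ r, (Xmat k *ᵥ U k) r ^ 2) ≥
        (n k : ℝ) / N * (v k * (∑ j, U k j ^ 2) -
          τ k * Real.sqrt (L / (n k : ℝ)) * (∑ j, |U k j|)) :=
      mul_le_mul_of_nonneg_left h (div_nonneg (hnpos k).le hNpos.le)
    have e1 : (n k : ℝ) / N * (1 / (n k : ℝ) * ∑ r, (Xmat k *ᵥ U k) r ^ 2)
        = (1 / N) * ∑ i, (Xmat k *ᵥ U k) i ^ 2 := by
      have := (hnpos k).ne'
      field_simp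
    rw [e1] at h2
    have e2 : (n k : ℝ) / N * (v k * (∑ j, U k j ^ 2) -
          τ k * Real.sqrt (L / (n k : ℝ)) * (∑ j, |U k j|)) =
        (v k * (n k : ℝ) / N) * (∑ j, U k j ^ 2) -
          τ k * Real.sqrt ((n k : ℝ) * L / N ^ 2) * ∑ j, |U k j| := by
      rw [hs]; ring
    rw [e2] at h2
    have h3 : m * (∑ j, U k j ^ 2) ≤ (v k * (n k : ℝ) / N) * (∑ j, U k j ^ 2) :=
      mul_le_mul_of_nonneg_right (hmle k) (Finset.sum_nonneg fun _ _ => sq_nonneg _)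
    have h4 : τ k * Real.sqrt ((n k : ℝ) * L / N ^ 2) * ∑ j, |U k j| ≤
        T * Real.sqrt ((n k : ℝ) * L / N ^ 2) * ∑ j, |U k j| :=
      mul_le_mul_of_nonneg_right (mul_le_mul_of_nonneg_right (hTle k) (Real.sqrt_nonneg _))
        (Finset.sum_nonneg fun _ _ => abs_nonneg _)
    linarith
  set a0 := ∑ j, Δ (0, j) ^ 2 with ha0
  set b0 := ∑ j, |Δ (0, j)| with hb0
  have hU0 : ∀ j, U 0 j = Δ (0, j) := fun j => by simp [hU, effU]
  have hUs : ∀ (k : Fin K) j, U k.succ j = Δ (k.succ, j) + Δ (0, j) := fun k j => by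
    simp [hU, effU, Fin.succ_ne_zero]
  have k0 := key 0
  simp only [hU0] at k0
  have ks : ∀ k : Fin K, (1 / N) * ∑ i, (Xmat k.succ *ᵥ U k.succ) i ^ 2 ≥
      m * (∑ j, U k.succ j ^ 2) - T * A * ((∑ j, |Δ (k.succ, j)|) + b0) := by
    intro k
    have h := key k.succ
    have h1 : Real.sqrt ((n k.succ : ℝ) * L / N ^ 2) ≤ A := by
      apply Real.sqrt_le_sqrt
      have := hMle k
      gcongr
    have h2 : ∑ j, |U k.succ j| ≤ (∑ j, |Δ (k.succ, j)|) + b0 := by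
      rw [hb0, ← Finset.sum_add_distrib]
      refine Finset.sum_le_sum fun j _ => ?_
      rw [hUs]; exact abs_add_le _ _
    have h3 : T * Real.sqrt ((n k.succ : ℝ) * L / N ^ 2) * ∑ j, |U k.succ j| ≤
        T * A * ((∑ j, |Δ (k.succ, j)|) + b0) := by
      have : 0 ≤ ∑ j, |U k.succ j| := Finset.sum_nonneg fun _ _ => abs_nonneg _
      gcongr
    linarith
  have sq : ∀ k : Fin K, ∑ j, Δ (k.succ, j) ^ 2 ≤ 2 * (∑ j, U k.succ j ^ 2) + 2 * a0 := by
    intro k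
    rw [ha0, Finset.mul_sum, Finset.mul_sum, ← Finset.sum_add_distrib]
    refine Finset.sum_le_sum fun j _ => ?_
    rw [hUs]
    nlinarith [sq_nonneg (Δ (k.succ, j) + 2 * Δ (0, j))]
  have kS := Finset.sum_le_sum fun k (_ : k ∈ (Finset.univ : Finset (Fin K))) => ks k
  have sS := Finset.sum_le_sum fun k (_ : k ∈ (Finset.univ : Finset (Fin K))) => sq k
  simp only [Finset.sum_add_distrib, Finset.sum_sub_distrib, ← Finset.mul_sum,
    Finset.sum_const, Finset.card_univ, Fintype.card_fin, nsmul_eq_mul] at kS sS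
  rw [Fintype.sum_prod_type, Fintype.sum_prod_type]
  rw [Fin.sum_univ_succ, Fin.sum_univ_succ, Fin.sum_univ_succ]
  rw [← ha0, ← hb0, mul_add]
  simp only [hU0] at *
  set S := ∑ k : Fin K, ∑ j, Δ (k.succ, j) ^ 2
  set b := ∑ k : Fin K, ∑ j, |Δ (k.succ, j)|
  set V := ∑ k : Fin K, ∑ j, U k.succ j ^ 2
  have hV : 0 ≤ V := Finset.sum_nonneg fun _ _ => Finset.sum_nonneg fun _ _ => sq_nonneg _
  have hb : 0 ≤ b := Finset.sum_nonneg fun _ _ => Finset.sum_nonneg fun _ _ => abs_nonneg _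
  have hb00 : 0 ≤ b0 := Finset.sum_nonneg fun _ _ => abs_nonneg _
  have hK1 : (1 : ℝ) ≤ K := by exact_mod_cast hK
  have f1 : (1 / (2 * (K : ℝ) + 1) * m) * (a0 + S) ≤ m * (V + a0) := by
    have : a0 + S ≤ (2 * (K : ℝ) + 1) * (V + a0) := by nlinarith
    have h' := mul_le_mul_of_nonneg_left this
      (show 0 ≤ 1 / (2 * (K : ℝ) + 1) * m by positivity)
    refine h'.trans (le_of_eq ?_)
    field_simp
  have f2 : T * A * (b + K * b0) + T * B * b0 ≤ ((K : ℝ) + 1) * T * (A + B) * (b0 + b) := by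
    have hTA : 0 ≤ T * A := by positivity
    have hTB : 0 ≤ T * B := by positivity
    have g1 : T * A * (b + K * b0) ≤ T * A * (((K : ℝ) + 1) * (b0 + b)) :=
      mul_le_mul_of_nonneg_left (by nlinarith) hTA
    have g2 : T * B * b0 ≤ T * B * (((K : ℝ) + 1) * (b0 + b)) :=
      mul_le_mul_of_nonneg_left (by nlinarith) hTB
    linarith
  linarith
end
end

section
/- Fix λ ≥ 0, L ≥ 0, τ ≥ 0 and let p_λ : ℝ → ℝ satisfy the regularity conditions (i)–(v). Then for every q ≥ 1 and every w ∈ ℝ^q one has λL ‖w‖₁ ≤ P_λ(w) + (τ/2) ‖w‖₂². -/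
open BigOperators

/-- The regularity conditions (i)--(v) on the scalar penalty `pl = p_λ`:
(i) `p_λ(0) = 0` and `p_λ` is symmetric around `0`;
(ii) `p_λ` is differentiable away from `0` and `lim_{t→0⁺} p_λ′(t) = λL`;
(iii) `p_λ` is nondecreasing on `[0, ∞)`;
(iv) `t ↦ p_λ(t)/t` is nonincreasing on `(0, ∞)`;
(v) `t ↦ p_λ(t) + (τ/2)t²` is convex. -/
def PenaltyConds (lam L τ : ℝ) (pl : ℝ → ℝ) : Prop :=
  pl 0 = 0 ∧ (∀ t : ℝ, pl t = pl (-t)) ∧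
  (∀ t : ℝ, t ≠ 0 → DifferentiableAt ℝ pl t) ∧
  Filter.Tendsto (deriv pl) (nhdsWithin 0 (Set.Ioi 0)) (nhds (lam * L)) ∧
  MonotoneOn pl (Set.Ici 0) ∧
  AntitoneOn (fun t => pl t / t) (Set.Ioi 0) ∧
  ConvexOn ℝ Set.univ (fun t => pl t + τ / 2 * t ^ 2)

theorem penalty_scalar_bound (lam L τ : ℝ) (pl : ℝ → ℝ) (hpl : PenaltyConds lam L τ pl)
    (t : ℝ) (ht : 0 ≤ t) : lam * L * t ≤ pl t + τ / 2 * t ^ 2 := by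
  obtain ⟨h0, -, hd, hlim, -, -, hc⟩ := hpl
  rcases ht.eq_or_lt with rfl | ht
  · simp [h0]
  have hcont : Continuous (fun t => pl t + τ / 2 * t ^ 2) :=
    continuousOn_univ.mp (hc.continuousOn isOpen_univ)
  have hid : Filter.Tendsto (fun s : ℝ => s) (nhdsWithin 0 (Set.Ioi 0)) (nhds 0) :=
    Filter.tendsto_id.mono_left nhdsWithin_le_nhds
  have hL1 : Filter.Tendsto (fun s => (deriv pl s + τ * s) * (t - s))
      (nhdsWithin 0 (Set.Ioi 0)) (nhds ((lam * L + τ * 0) * (t - 0))) :=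
    (hlim.add (hid.const_mul τ)).mul (tendsto_const_nhds.sub hid)
  have hR1 : Filter.Tendsto (fun s => (pl t + τ / 2 * t ^ 2) - (pl s + τ / 2 * s ^ 2))
      (nhdsWithin 0 (Set.Ioi 0)) (nhds ((pl t + τ / 2 * t ^ 2) - (pl 0 + τ / 2 * 0 ^ 2))) :=
    tendsto_const_nhds.sub ((hcont.tendsto 0).mono_left nhdsWithin_le_nhds)
  have hle := le_of_tendsto_of_tendsto hL1 hR1 (by
    filter_upwards [Ioo_mem_nhdsGT ht] with s hs
    have hder : HasDerivAt (fun t => pl t + τ / 2 * t ^ 2) (deriv pl s + τ * s) s := by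
      have h2 := (hd s hs.1.ne').hasDerivAt.fun_add ((hasDerivAt_pow 2 s).const_mul (τ / 2))
      refine h2.congr_deriv ?_
      norm_num
      ring
    have h3 := hc.le_slope_of_hasDerivAt (Set.mem_univ s) (Set.mem_univ t) hs.2 hder
    rw [slope_def_field, le_div_iff₀ (sub_pos.mpr hs.2)] at h3
    exact h3)
  simpa [h0] using hle

/-- Part 1 of Lemma A.2 of the paper (Lemma 4(b) of Loh--Wainwright):
`λL ‖w‖₁ ≤ P_λ(w) + (τ/2)‖w‖₂²` where `P_λ(w) = ∑ⱼ p_λ(|wⱼ|)`. -/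
theorem penalty_lower_bound (lam L τ : ℝ) (hlam : 0 ≤ lam) (hL : 0 ≤ L) (hτ : 0 ≤ τ)
    (pl : ℝ → ℝ) (hpl : PenaltyConds lam L τ pl) :
    ∀ q : ℕ, 1 ≤ q → ∀ w : Fin q → ℝ,
      lam * L * (∑ j, |w j|) ≤ (∑ j, pl |w j|) + τ / 2 * ∑ j, w j ^ 2 := by
  intro q _ w
  rw [Finset.mul_sum, Finset.mul_sum, ← Finset.sum_add_distrib]
  refine Finset.sum_le_sum fun j _ => ?_
  have h := penalty_scalar_bound lam L τ pl hpl |w j| (abs_nonneg _)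
  rwa [sq_abs] at h
end

section
/- Fix λ ≥ 0, L ≥ 0, τ ≥ 0 and let p_λ : ℝ → ℝ satisfy the regularity conditions (i)–(v). Let q ≥ 1, v ∈ ℝ^q, s* ∈ {0, 1, …, q}, and let I ⊆ {1, …, q} with |I| = s* be a set of indices of the s* largest coordinates of v in absolute value (i.e., |v_j| ≤ |v_i| for every i ∈ I and j ∉ I). Suppose ξ > 0 is such that ξ P_λ(v_I) − P_λ(v_{I^c}) ≥ 0. Then ξ P_λ(v_I) − P_λ(v_{I^c}) ≤ λL (ξ ‖v_I‖₁ − ‖v_{I^c}‖₁). -/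
open BigOperators

theorem pen_upper (lam L τ : ℝ) (pl : ℝ → ℝ) (hpl : PenaltyConds lam L τ pl)
    (t : ℝ) (ht : 0 < t) : pl t / t ≤ lam * L := by
  obtain ⟨h0, hsym, hd, hlim, hmono, hanti, hconv⟩ := hpl
  have hcont : Continuous pl := by
    have h1 : Continuous (fun t => pl t + τ / 2 * t ^ 2) := by
      rw [← continuousOn_univ]
      exact hconv.continuousOn isOpen_univ
    have h2 : Continuous (fun t => (pl t + τ / 2 * t ^ 2) - τ / 2 * t ^ 2) :=
      h1.sub (by fun_prop)
    simpa using h2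
  refine le_of_forall_pos_le_add fun ε hε => ?_
  have hev := hlim.eventually (gt_mem_nhds (show lam * L < lam * L + ε by linarith))
  obtain ⟨δ, hδ, hδ'⟩ := mem_nhdsGT_iff_exists_Ioo_subset.1 hev
  have hδ0 : 0 < δ := hδ
  have hs : 0 < min δ t := lt_min hδ0 ht
  obtain ⟨c, hc, hc'⟩ := exists_deriv_eq_slope pl hs hcont.continuousOn
    (fun x hx => (hd x hx.1.ne').differentiableWithinAt)
  have h3 : deriv pl c < lam * L + ε := hδ' ⟨hc.1, lt_of_lt_of_le hc.2 (min_le_left _ _)⟩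
  rw [h0, sub_zero, sub_zero] at hc'
  have h4 : pl t / t ≤ pl (min δ t) / min δ t := hanti hs ht (min_le_right _ _)
  linarith

theorem pen_zero (lam L τ : ℝ) (pl : ℝ → ℝ) (hpl : PenaltyConds lam L τ pl)
    (t : ℝ) (ht : 0 < t) (hz : pl t = 0) : lam * L = 0 := by
  obtain ⟨h0, hsym, hd, hlim, hmono, hanti, hconv⟩ := hpl
  have hzero : ∀ x ∈ Set.Ioo 0 t, pl x = 0 := fun x hx => by
    have h1 := hmono (Set.mem_Ici.2 le_rfl) (Set.mem_Ici.2 hx.1.le) hx.1.le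
    have h2 := hmono (Set.mem_Ici.2 hx.1.le) (Set.mem_Ici.2 ht.le) hx.2.le
    linarith
  refine tendsto_nhds_unique hlim ?_
  refine tendsto_const_nhds.congr' ?_
  filter_upwards [Ioo_mem_nhdsGT ht] with x hx
  have : pl =ᶠ[nhds x] fun _ => (0 : ℝ) := by
    filter_upwards [isOpen_Ioo.mem_nhds hx] with y hy using hzero y hy
  rw [this.deriv_eq]
  simp

/-- The comparison slope. -/
theorem pen_slope (lam L τ : ℝ) (hM : 0 ≤ lam * L) (pl : ℝ → ℝ)
    (hpl : PenaltyConds lam L τ pl)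
    (q : ℕ) (v : Fin q → ℝ) (I : Finset (Fin q))
    (hlargest : ∀ i ∈ I, ∀ j ∉ I, |v j| ≤ |v i|) :
    ∃ f : ℝ, 0 ≤ f ∧ f ≤ lam * L ∧ (f = 0 → lam * L = 0) ∧
      (∀ i ∈ I, pl |v i| ≤ f * |v i|) ∧ (∀ j ∉ I, f * |v j| ≤ pl |v j|) := by
  have hup := pen_upper lam L τ pl hpl
  have hz := pen_zero lam L τ pl hpl
  obtain ⟨h0, hsym, hd, hlim, hmono, hanti, hconv⟩ := hpl
  have key : ∀ t : ℝ, 0 < t → (∀ i ∈ I, t ≤ |v i|) → (∀ j ∉ I, |v j| ≤ t) →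
      ∃ f : ℝ, 0 ≤ f ∧ f ≤ lam * L ∧ (f = 0 → lam * L = 0) ∧
      (∀ i ∈ I, pl |v i| ≤ f * |v i|) ∧ (∀ j ∉ I, f * |v j| ≤ pl |v j|) := by
    intro t ht hI hJ
    have hp : 0 ≤ pl t := by
      have := hmono (Set.mem_Ici.2 le_rfl) (Set.mem_Ici.2 ht.le) ht.le
      linarith
    refine ⟨pl t / t, by positivity, hup t ht, ?_, ?_, ?_⟩
    · intro h
      rcases div_eq_zero_iff.1 h with h | h
      · exact hz t ht h
      · exact absurd h ht.ne'
    · intro i hi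
      have hvi : 0 < |v i| := lt_of_lt_of_le ht (hI i hi)
      exact (div_le_iff₀ hvi).1 (hanti ht hvi (hI i hi))
    · intro j hj
      rcases (abs_nonneg (v j)).eq_or_lt with h | h
      · rw [← h, h0]; simp
      · exact (le_div_iff₀ h).1 (hanti h ht (hJ j hj))
  rcases I.eq_empty_or_nonempty with rfl | hne
  · refine key (1 + ∑ j, |v j|) (by positivity) (by simp) fun j _ => ?_
    have := Finset.single_le_sum (f := fun j => |v j|) (fun i _ => abs_nonneg _)
      (Finset.mem_univ j)
    linarith
  · obtain ⟨i₀, hi₀, hmin⟩ := I.exists_min_image (fun i => |v i|) hne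
    rcases (abs_nonneg (v i₀)).eq_or_lt with h | h
    · refine ⟨lam * L, hM, le_rfl, id, ?_, ?_⟩
      · intro i _
        rcases (abs_nonneg (v i)).eq_or_lt with h | h
        · rw [← h, h0]; simp
        · exact (div_le_iff₀ h).1 (hup _ h)
      · intro j hj
        have : |v j| = 0 := le_antisymm (h ▸ hlargest i₀ hi₀ j hj) (abs_nonneg _)
        rw [this, h0]; simp
    · exact key _ h hmin (hlargest i₀ hi₀)

/-- Part 2 of Lemma A.2 of the paper (Lemma 5 of Loh--Wainwright).  Here
`v_I` is the vector equal to `v` on the index set `I` of the `s*` largest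
coordinates of `v` in absolute value and `0` elsewhere, and `v_{I^c}` is the
complementary part; `P_λ(w) = ∑ⱼ p_λ(|wⱼ|)`. -/
theorem penalty_cone_bound (lam L τ : ℝ) (hlam : 0 ≤ lam) (hL : 0 ≤ L) (hτ : 0 ≤ τ)
    (pl : ℝ → ℝ) (hpl : PenaltyConds lam L τ pl)
    (q : ℕ) (hq : 1 ≤ q) (v : Fin q → ℝ) (sstar : ℕ) (hs : sstar ≤ q)
    (I : Finset (Fin q)) (hcard : I.card = sstar)
    (hlargest : ∀ i ∈ I, ∀ j ∉ I, |v j| ≤ |v i|)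
    (ξ : ℝ) (hξ : 0 < ξ)
    (hpos : 0 ≤ ξ * (∑ j, pl |if j ∈ I then v j else 0|) -
        ∑ j, pl |if j ∈ I then 0 else v j|) :
    ξ * (∑ j, pl |if j ∈ I then v j else 0|) -
        (∑ j, pl |if j ∈ I then 0 else v j|) ≤
      lam * L * (ξ * (∑ j, |if j ∈ I then v j else 0|) -
        ∑ j, |if j ∈ I then 0 else v j|) := by
  have hM : 0 ≤ lam * L := mul_nonneg hlam hL
  obtain ⟨f, hf0, hfM, hfz, hI, hJ⟩ := pen_slope lam L τ hM pl hpl q v I hlargest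
  have h0 : pl 0 = 0 := hpl.1
  have h1 : ∑ j, pl |if j ∈ I then v j else 0| ≤ f * ∑ j, |if j ∈ I then v j else 0| := by
    rw [Finset.mul_sum]
    refine Finset.sum_le_sum fun j _ => ?_
    by_cases h : j ∈ I
    · simpa [h] using hI j h
    · simp [h, h0]
  have h2 : f * ∑ j, |if j ∈ I then 0 else v j| ≤ ∑ j, pl |if j ∈ I then 0 else v j| := by
    rw [Finset.mul_sum]
    refine Finset.sum_le_sum fun j _ => ?_
    by_cases h : j ∈ I
    · simp [h, h0]
    · simpa [h] using hJ j h
  generalize (∑ j, pl |if j ∈ I then v j else 0|) = A at *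
  generalize (∑ j, pl |if j ∈ I then 0 else v j|) = B at *
  generalize (∑ j, |if j ∈ I then v j else 0|) = C at *
  generalize (∑ j, |if j ∈ I then 0 else v j|) = D at *
  have h3 : ξ * A - B ≤ f * (ξ * C - D) := by
    have := mul_le_mul_of_nonneg_left h1 hξ.le
    linarith
  rcases hf0.eq_or_lt with h | h
  · rw [hfz h.symm, h]; exact h3
  · have h4 : 0 ≤ ξ * C - D := nonneg_of_mul_nonneg_right (hpos.trans h3) h
    exact h3.trans (mul_le_mul_of_nonneg_right hfM h4)
end

section
/- Let n ≥ 1, q ≥ 1, X ∈ ℝ^{n × q}, y ∈ ℝ^n, and set Σ̂ = (1/n) Xᵀ X. Let τ ≥ 0, v > 0, κ ≥ 0, and let P : ℝ^q → ℝ be such that w ↦ P(w) + (τ/2) ‖w‖₂² is convex and P is differentiable at β̂ ∈ ℝ^q. Suppose: (a) the first-order stationarity condition Σ̂ β̂ − (1/n) Xᵀ y + ∇P(β̂) = 0 holds; and (b) with Δ̂ = β̂ − β for a given β ∈ ℝ^q, the restricted strong convexity bound Δ̂ᵀ Σ̂ Δ̂ ≥ v ‖Δ̂‖₂² − κ ‖Δ̂‖₁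 holds. Then (v − τ/2) ‖Δ̂‖₂² ≤ P(β) − P(β̂) + ( ‖Σ̂ β − (1/n) Xᵀ y‖_∞ + κ ) ‖Δ̂‖₁. -/
open Matrix BigOperators

/-- The deterministic basic inequality that is the central displayed inequality
in the proof of Theorem 2 of the paper.  Here `Σ̂ = (1/n) XᵀX`, the gradient
`∇P(β̂) = g` is expressed via the Fréchet derivative `L` of `P` at `β̂`
(`L w = ⟨g, w⟩`), (a) is the first-order stationarity condition
`Σ̂ β̂ − (1/n) Xᵀy + ∇P(β̂) = 0`, and (b) is the restricted strong convexity
bound for `Δ̂ = β̂ − β`. -/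
theorem basic_inequality (n q : ℕ) (hn : 1 ≤ n) (hq : 1 ≤ q)
    (X : Matrix (Fin n) (Fin q) ℝ) (y : Fin n → ℝ)
    (τ v κ : ℝ) (hτ : 0 ≤ τ) (hv : 0 < v) (hκ : 0 ≤ κ)
    (P : (Fin q → ℝ) → ℝ)
    (hconv : ConvexOn ℝ Set.univ (fun w => P w + τ / 2 * ∑ i, w i ^ 2))
    (βhat β g : Fin q → ℝ) (L : (Fin q → ℝ) →L[ℝ] ℝ)
    (hL : HasFDerivAt P L βhat) (hLg : ∀ w, L w = ∑ i, g i * w i)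
    (hstat : ((1 / (n : ℝ)) • (Xᵀ * X)) *ᵥ βhat - (1 / (n : ℝ)) • (Xᵀ *ᵥ y) + g = 0)
    (hRSC : (fun i => βhat i - β i) ⬝ᵥ
          (((1 / (n : ℝ)) • (Xᵀ * X)) *ᵥ fun i => βhat i - β i) ≥
        v * (∑ i, (βhat i - β i) ^ 2) - κ * ∑ i, |βhat i - β i|) :
    (v - τ / 2) * (∑ i, (βhat i - β i) ^ 2) ≤
      P β - P βhat +
        ((⨆ j, |(((1 / (n : ℝ)) • (Xᵀ * X)) *ᵥ β - (1 / (n : ℝ)) • (Xᵀ *ᵥ y)) j|) + κ) *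
          ∑ i, |βhat i - β i| := by
  set S := ((1 / (n : ℝ)) • (Xᵀ * X)) with hS
  set c := (1 / (n : ℝ)) • (Xᵀ *ᵥ y) with hc
  -- first-order convexity inequality
  have h1 : (∑ i, g i * (β i - βhat i)) - τ / 2 * ∑ i, (βhat i - β i) ^ 2 ≤ P β - P βhat := by
    have hφ := hconv.comp_affineMap (AffineMap.lineMap (k := ℝ) βhat β)
    have hline : HasDerivAt (fun t : ℝ => AffineMap.lineMap (k := ℝ) βhat β t) (β - βhat) 0 :=
      AffineMap.hasDerivAt_lineMap
    have hP : HasDerivAt (fun t : ℝ => P (AffineMap.lineMap (k := ℝ) βhat β t))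
        (L (β - βhat)) 0 := by
      have hL' : HasFDerivAt P L (AffineMap.lineMap (k := ℝ) βhat β (0 : ℝ)) := by
        simpa using hL
      exact hL'.comp_hasDerivAt (0 : ℝ) hline
    have hsq : HasDerivAt
        (fun t : ℝ => ∑ i, (AffineMap.lineMap (k := ℝ) βhat β t) i ^ 2)
        (∑ i, 2 * βhat i * (β i - βhat i)) 0 := by
      refine HasDerivAt.fun_sum fun i _ => ?_
      have := ((hasDerivAt_pi.1 hline) i).fun_pow 2
      simpa using this
    have hd := hP.fun_add (hsq.const_mul (τ / 2))
    have hle := ConvexOn.le_slope_of_hasDerivAt hφ (x := 0) (y := 1) (by simp) (by simp)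
      zero_lt_one hd
    rw [hLg] at hle
    simp only [slope_def_field, Function.comp, AffineMap.lineMap_apply_zero,
      AffineMap.lineMap_apply_one, Pi.sub_apply, sub_zero, div_one] at hle
    have e : ∑ i, (βhat i - β i) ^ 2 =
        ∑ i, β i ^ 2 - ∑ i, βhat i ^ 2 - ∑ i, 2 * βhat i * (β i - βhat i) := by
      rw [← Finset.sum_sub_distrib, ← Finset.sum_sub_distrib]
      exact Finset.sum_congr rfl fun i _ => by ring
    rw [e]
    linarith
  -- Hölder
  have h2 : -(∑ i, (S *ᵥ β - c) i * (βhat i - β i)) ≤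
      (⨆ j, |(S *ᵥ β - c) j|) * ∑ i, |βhat i - β i| := by
    rw [← Finset.sum_neg_distrib, Finset.mul_sum]
    refine Finset.sum_le_sum fun i _ => ?_
    refine (neg_le_abs _).trans ?_
    rw [abs_mul]
    exact mul_le_mul_of_nonneg_right
      (le_ciSup (f := fun j => |(S *ᵥ β - c) j|) (Set.finite_range _).bddAbove i) (abs_nonneg _)
  -- stationarity
  have h3 : (fun i => βhat i - β i) ⬝ᵥ (S *ᵥ fun i => βhat i - β i) =
      ∑ i, g i * (β i - βhat i) + -(∑ i, (S *ᵥ β - c) i * (βhat i - β i)) := by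
    have e : (S *ᵥ fun i => βhat i - β i) = S *ᵥ βhat - S *ᵥ β := Matrix.mulVec_sub S βhat β
    rw [e, dotProduct, ← Finset.sum_neg_distrib, ← Finset.sum_add_distrib]
    refine Finset.sum_congr rfl fun i _ => ?_
    have hi := congrFun hstat i
    simp only [Pi.add_apply, Pi.sub_apply, Pi.zero_apply] at hi ⊢
    have : (S *ᵥ βhat) i = c i - g i := by linarith
    rw [this]
    ring
  rw [h3] at hRSC
  linarith
end
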